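/- arXiv:2304.00803 — 6 statements merged into one kernel-verified Lean document; each statement's English description precedes it below -/
import Mathlib

section
/- Consider a finite Markov Decision Process with state set of size n, action set of size m, row-stochastic matrices A^k ∈ ℝ^{n×n} for each action k, reward function R : [n]×[m] → ℝ, and discount factor γ ∈ (0,1). Let v̄ ∈ ℝ^n be the unique fixed point of the Bellman iteration map B defined by (Bv)_i = max_{k ∈ [m]} [ R(i,k) + γ Σ_{j=1}^n a^k_{ij} v_j ]. Then for every state i, v̄_i = max over all deterministic policies π : [n] → [m] of (V_π)_i, where V_π is the value vector of the policy π. Moreover there exists a single deterministic policy π* achieving this maximum simultaneously for all states i. -/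
/-- Maximum principle for a discounted row-stochastic matrix: a vector dominated by its own
discounted average is nonpositive. -/
theorem nonpos_of_le_discounted_average {ι : Type*} [Fintype ι] {P : Matrix ι ι ℝ}
    (hP0 : ∀ i j, 0 ≤ P i j) (hP1 : ∀ i, ∑ j, P i j = 1) {γ : ℝ} (hγ0 : 0 ≤ γ) (hγ1 : γ < 1)
    {d : ι → ℝ} (hd : ∀ i, d i ≤ γ * ∑ j, P i j * d j) (i : ι) : d i ≤ 0 := by
  have : Nonempty ι := ⟨i⟩
  obtain ⟨i₀, hi₀⟩ := Finite.exists_max d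
  have havg : ∑ j, P i₀ j * d j ≤ d i₀ :=
    calc ∑ j, P i₀ j * d j ≤ ∑ j, P i₀ j * d i₀ :=
          Finset.sum_le_sum fun j _ => mul_le_mul_of_nonneg_left (hi₀ j) (hP0 i₀ j)
      _ = d i₀ := by rw [← Finset.sum_mul, hP1, one_mul]
  have hle : d i₀ ≤ γ * d i₀ := (hd i₀).trans (mul_le_mul_of_nonneg_left havg hγ0)
  have hmax : d i₀ ≤ 0 := by nlinarith
  exact (hi₀ i).trans hmax

/-- Comparison principle for discounted policy evaluation: a subsolution lies below every
supersolution. -/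
theorem le_of_discounted_sub_super {ι : Type*} [Fintype ι] {P : Matrix ι ι ℝ}
    (hP0 : ∀ i j, 0 ≤ P i j) (hP1 : ∀ i, ∑ j, P i j = 1) {γ : ℝ} (hγ0 : 0 ≤ γ) (hγ1 : γ < 1)
    {r u v : ι → ℝ} (hu : ∀ i, u i ≤ r i + γ * ∑ j, P i j * u j)
    (hv : ∀ i, r i + γ * ∑ j, P i j * v j ≤ v i) (i : ι) : u i ≤ v i := by
  refine sub_nonpos.mp (nonpos_of_le_discounted_average hP0 hP1 hγ0 hγ1
    (d := fun i => u i - v i) (fun i => ?_) i)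
  simp only [mul_sub, Finset.sum_sub_distrib]
  linarith [hu i, hv i]

/-- the unique fixed point `v̄` of the Bellman iteration map equals,
in each component `i`, the maximum over all deterministic policies `π : [n] → [m]`
of the value `(V_π)_i`, and moreover a single deterministic policy `π*` attains
this maximum simultaneously in every state.  Here `Vpol π` is the value vector of
the policy `π`, i.e. the unique solution of `v = r_π + γ A_π v`. -/
theorem stmt2 (n m : ℕ) (hm : 0 < m)
    (A : Fin m → Matrix (Fin n) (Fin n) ℝ)
    (hA0 : ∀ k i j, 0 ≤ A k i j) (hA1 : ∀ k i, ∑ j, A k i j = 1)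
    (R : Fin n → Fin m → ℝ) (γ : ℝ) (hγ0 : 0 < γ) (hγ1 : γ < 1)
    (Vpol : (Fin n → Fin m) → (Fin n → ℝ))
    (hVpol : ∀ (π : Fin n → Fin m) (i : Fin n),
      Vpol π i = R i (π i) + γ * ∑ j, A (π i) i j * Vpol π j)
    (vbar : Fin n → ℝ)
    (hvbar : ∀ i, vbar i =
      Finset.univ.sup' (Finset.univ_nonempty_iff.mpr ⟨⟨0, hm⟩⟩)
        (fun k : Fin m => R i k + γ * ∑ j, A k i j * vbar j)) :
    (∀ i, vbar i =
      Finset.univ.sup' (Finset.univ_nonempty_iff.mpr ⟨fun _ => ⟨0, hm⟩⟩)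
        (fun π : Fin n → Fin m => Vpol π i)) ∧
    (∃ πstar : Fin n → Fin m, ∀ i, Vpol πstar i = vbar i) := by
  have hbellman : ∀ i k, R i k + γ * ∑ j, A k i j * vbar j ≤ vbar i := fun i k => by
    rw [hvbar i]
    exact Finset.le_sup' (fun k => R i k + γ * ∑ j, A k i j * vbar j) (Finset.mem_univ k)
  have hle : ∀ π i, Vpol π i ≤ vbar i := fun π =>
    le_of_discounted_sub_super (P := fun i => A (π i) i) (r := fun i => R i (π i))
      (fun i => hA0 (π i) i) (fun i => hA1 (π i) i) hγ0.le hγ1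
      (fun i => (hVpol π i).le) (fun i => hbellman i (π i))
  have hgreedy : ∀ i, ∃ k, vbar i = R i k + γ * ∑ j, A k i j * vbar j := fun i => by
    obtain ⟨k, -, hk⟩ := Finset.exists_mem_eq_sup' (Finset.univ_nonempty_iff.mpr ⟨⟨0, hm⟩⟩)
      (fun k : Fin m => R i k + γ * ∑ j, A k i j * vbar j)
    exact ⟨k, (hvbar i).trans hk⟩
  choose πstar hπstar using hgreedy
  have hge : ∀ i, vbar i ≤ Vpol πstar i :=
    le_of_discounted_sub_super (P := fun i => A (πstar i) i) (r := fun i => R i (πstar i))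
      (fun i => hA0 (πstar i) i) (fun i => hA1 (πstar i) i) hγ0.le hγ1
      (fun i => (hπstar i).le) (fun i => (hVpol πstar i).ge)
  refine ⟨fun i => le_antisymm ?_ ?_, πstar, fun i => le_antisymm (hle πstar i) (hge i)⟩
  · exact (hge i).trans
      (Finset.le_sup' (fun π : Fin n → Fin m => Vpol π i) (Finset.mem_univ πstar))
  · exact Finset.sup'_le _ _ fun π _ => hle π i
end

section
/- Consider a finite Markov Decision Process with state set of size n, action set of size m, row-stochastic matrices A^k ∈ ℝ^{n×n} for each action k, reward function R : [n]×[m] → ℝ, and discount factor γ ∈ (0,1). For every state i, the supremum over all probabilistic policies Φ of (V_Φ)_i equals the maximum over all deterministic policies π : [n] → [m] of (V_π)_i, where V_Φ and V_π denote the corresponding value vectors. -/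
/-- A vector dominated by the `γ`-discounted average of itself along a stochastic matrix is
nonpositive. -/
theorem nonpos_of_le_discounted_mulVec {ι : Type*} [Fintype ι] {P : ι → ι → ℝ}
    (hP0 : ∀ s j, 0 ≤ P s j) (hP1 : ∀ s, ∑ j, P s j = 1) {γ : ℝ} (hγ0 : 0 ≤ γ) (hγ1 : γ < 1)
    {d : ι → ℝ} (hd : ∀ s, d s ≤ γ * ∑ j, P s j * d j) (i : ι) : d i ≤ 0 := by
  obtain ⟨s, -, hs⟩ := Finset.exists_max_image Finset.univ d ⟨i, Finset.mem_univ i⟩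
  have hsum : ∑ j, P s j * d j ≤ d s := by
    calc ∑ j, P s j * d j ≤ ∑ j, P s j * d s :=
          Finset.sum_le_sum fun j hj => mul_le_mul_of_nonneg_left (hs j hj) (hP0 s j)
      _ = d s := by rw [← Finset.sum_mul, hP1, one_mul]
  have hds : d s ≤ γ * d s := (hd s).trans (mul_le_mul_of_nonneg_left hsum hγ0)
  have hle : d s ≤ 0 := by nlinarith
  exact (hs i (Finset.mem_univ i)).trans hle

/-- A weighted average is at most one of the averaged values. -/
theorem exists_sum_mul_le_of_sum_eq_one {κ : Type*} [Fintype κ] [Nonempty κ] {w : κ → ℝ}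
    (hw0 : ∀ k, 0 ≤ w k) (hw1 : ∑ k, w k = 1) (f : κ → ℝ) : ∃ k, ∑ l, w l * f l ≤ f k := by
  obtain ⟨k, -, hk⟩ := Finset.exists_max_image Finset.univ f Finset.univ_nonempty
  refine ⟨k, ?_⟩
  calc ∑ l, w l * f l ≤ ∑ l, w l * f k :=
        Finset.sum_le_sum fun l hl => mul_le_mul_of_nonneg_left (hk l hl) (hw0 l)
    _ = f k := by rw [← Finset.sum_mul, hw1, one_mul]


/-- for each state `i`, the supremum over all probabilistic policies
`Φ` of the value `(V_Φ)_i` equals the maximum over all deterministic policies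
`π` of `(V_π)_i`.  A probabilistic policy assigns to each state a probability
vector `Φ s` over actions; its value vector is the unique solution of
`v = r_Φ + γ A_Φ v`, where `(A_Φ)_{sj} = Σ_k Φ_{sk} a^k_{sj}` and
`(r_Φ)_s = Σ_k Φ_{sk} R(s,k)`. -/
theorem stmt3 (n m : ℕ) (hm : 0 < m)
    (A : Fin m → Matrix (Fin n) (Fin n) ℝ)
    (hA0 : ∀ k i j, 0 ≤ A k i j) (hA1 : ∀ k i, ∑ j, A k i j = 1)
    (R : Fin n → Fin m → ℝ) (γ : ℝ) (hγ0 : 0 < γ) (hγ1 : γ < 1)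
    (Vpol : (Fin n → Fin m) → (Fin n → ℝ))
    (hVpol : ∀ (π : Fin n → Fin m) (i : Fin n),
      Vpol π i = R i (π i) + γ * ∑ j, A (π i) i j * Vpol π j)
    (i : Fin n) :
    sSup { x : ℝ | ∃ (Φ : Fin n → Fin m → ℝ) (v : Fin n → ℝ),
        (∀ s k, 0 ≤ Φ s k) ∧ (∀ s, ∑ k, Φ s k = 1) ∧
        (∀ s, v s = (∑ k, Φ s k * R s k) +
          γ * ∑ j, (∑ k, Φ s k * A k s j) * v j) ∧
        x = v i } =
      Finset.univ.sup' (Finset.univ_nonempty_iff.mpr ⟨fun _ => ⟨0, hm⟩⟩)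
        (fun π : Fin n → Fin m => Vpol π i) := by
  have hne : Nonempty (Fin m) := ⟨⟨0, hm⟩⟩
  refine IsGreatest.csSup_eq ⟨?_, ?_⟩
  · obtain ⟨π, -, hπ⟩ := Finset.exists_mem_eq_sup' (s := Finset.univ)
      (Finset.univ_nonempty_iff.mpr ⟨fun _ => ⟨0, hm⟩⟩) (fun π : Fin n → Fin m => Vpol π i)
    refine ⟨fun s k => if k = π s then 1 else 0, Vpol π, ?_, ?_, ?_, hπ⟩
    · intro s k
      dsimp only
      split_ifs <;> norm_num
    · intro s
      simp
    · intro s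
      simpa using hVpol π s
  · rintro x ⟨Φ, v, hΦ0, hΦ1, hv, rfl⟩
    have havg : ∀ s, v s = ∑ k, Φ s k * (R s k + γ * ∑ j, A k s j * v j) := by
      intro s
      rw [hv s]
      simp only [mul_add, Finset.sum_add_distrib, Finset.sum_mul, Finset.mul_sum]
      rw [Finset.sum_comm]
      congr 1
      refine Finset.sum_congr rfl fun k _ => Finset.sum_congr rfl fun j _ => ?_
      ring
    choose π hπ using fun s => exists_sum_mul_le_of_sum_eq_one (hΦ0 s) (hΦ1 s)
      fun k => R s k + γ * ∑ j, A k s j * v j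
    have hle : v i - Vpol π i ≤ 0 := by
      refine nonpos_of_le_discounted_mulVec (P := fun s j => A (π s) s j)
        (d := fun s => v s - Vpol π s) (fun s j => hA0 _ s j) (fun s => hA1 _ s)
        hγ0.le hγ1 (fun s => ?_) i
      have hs := hπ s
      rw [← havg s] at hs
      simp only [mul_sub, Finset.sum_sub_distrib]
      linarith [hVpol π s]
    exact (sub_nonpos.mp hle).trans
      (Finset.le_sup' (fun π : Fin n → Fin m => Vpol π i) (Finset.mem_univ π))
end

section
/- Let A ∈ ℝ^{n×n} be a row-stochastic matrix with stationary distribution μ (μᵀA = μᵀ), let M = diag(μ), let r ∈ ℝ^n, and let γ ∈ (0,1). Then the affine map v ↦ r + γ A v is a contraction with respect to the weighted norm ‖·‖_M with contraction constant γ: ‖(r + γAv₁) − (r + γAv₂)‖_M ≤ γ ‖v₁ − v₂‖_M for all v₁, v₂ ∈ ℝ^n. -/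
/-- Averaging by a nonnegative matrix with unit row sums does not increase the second moment
with respect to a nonnegative invariant weight. -/
theorem sum_weight_mul_sq_average_le {ι : Type*} [Fintype ι] (A : Matrix ι ι ℝ)
    (hA0 : ∀ i j, 0 ≤ A i j) (hA1 : ∀ i, ∑ j, A i j = 1)
    (μ : ι → ℝ) (hμ0 : ∀ i, 0 ≤ μ i) (hstat : ∀ j, ∑ i, μ i * A i j = μ j) (w : ι → ℝ) :
    ∑ i, μ i * (∑ j, A i j * w j) ^ 2 ≤ ∑ i, μ i * w i ^ 2 :=
  calc
    ∑ i, μ i * (∑ j, A i j * w j) ^ 2 ≤ ∑ i, μ i * ∑ j, A i j * w j ^ 2 := by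
      gcongr with i
      · exact hμ0 i
      · exact Real.pow_arith_mean_le_arith_mean_pow_of_even _ _ _ (fun j _ => hA0 i j) (hA1 i)
          even_two
    _ = ∑ j, ∑ i, μ i * A i j * w j ^ 2 := by
      rw [Finset.sum_comm]
      simp only [Finset.mul_sum, mul_assoc]
    _ = ∑ j, μ j * w j ^ 2 := by
      simp only [← Finset.sum_mul, hstat]

/-- if `A` is row-stochastic with stationary distribution `μ`,
`r ∈ ℝⁿ` and `γ ∈ (0,1)`, then the affine map `v ↦ r + γ A v` is a contraction
with constant `γ` in the weighted norm `‖v‖_M = (Σ_i μ_i v_i²)^{1/2}`. -/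
theorem stmt9 (n : ℕ) (A : Matrix (Fin n) (Fin n) ℝ)
    (hA0 : ∀ i j, 0 ≤ A i j) (hA1 : ∀ i, ∑ j, A i j = 1)
    (μ : Fin n → ℝ) (hμ0 : ∀ i, 0 ≤ μ i) (hμ1 : ∑ i, μ i = 1)
    (hstat : ∀ j, ∑ i, μ i * A i j = μ j)
    (r : Fin n → ℝ) (γ : ℝ) (hγ0 : 0 < γ) (hγ1 : γ < 1)
    (v₁ v₂ : Fin n → ℝ) :
    Real.sqrt (∑ i, μ i *
        ((r i + γ * ∑ j, A i j * v₁ j) - (r i + γ * ∑ j, A i j * v₂ j)) ^ 2) ≤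
      γ * Real.sqrt (∑ i, μ i * (v₁ i - v₂ i) ^ 2) := by
  have hdiff (i : Fin n) :
      (r i + γ * ∑ j, A i j * v₁ j) - (r i + γ * ∑ j, A i j * v₂ j) =
        γ * ∑ j, A i j * (v₁ j - v₂ j) := by
    simp only [mul_sub, Finset.sum_sub_distrib]
    ring
  have hscale : ∑ i, μ i * (γ * ∑ j, A i j * (v₁ j - v₂ j)) ^ 2 =
      γ ^ 2 * ∑ i, μ i * (∑ j, A i j * (v₁ j - v₂ j)) ^ 2 := by
    rw [Finset.mul_sum]
    exact Finset.sum_congr rfl fun i _ => by ring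
  simp only [hdiff]
  rw [hscale, Real.sqrt_mul (sq_nonneg γ), Real.sqrt_sq hγ0.le]
  gcongr γ * √?_
  exact sum_weight_mul_sq_average_le A hA0 hA1 μ hμ0 hstat fun j => v₁ j - v₂ j
end

section
/- Let A ∈ ℝ^{n×n} be a row-stochastic matrix with stationary distribution μ (μᵀA = μᵀ), let M = diag(μ), let r ∈ ℝ^n, γ ∈ (0,1), and λ ∈ [0,1). Define T^λ : ℝ^n → ℝ^n by T^λ v = (1−λ) Σ_{l=0}^∞ λ^l [ Σ_{τ=0}^l γ^τ A^τ r + γ^{l+1} A^{l+1} v ]. Then T^λ is a contraction with respect to the weighted norm ‖·‖_M with contraction constant γ(1−λ)/(1−γλ): ‖T^λ v₁ − T^λ v₂‖_M ≤ [γ(1−λ)/(1−γλ)] ‖v₁ − v₂‖_M for all v₁, v₂ ∈ ℝ^n. -/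
/-- A row-stochastic matrix is nonexpansive in the sup norm. -/
theorem norm_mulVec_le_of_rowStochastic {ι : Type*} [Fintype ι] {A : Matrix ι ι ℝ}
    (hA0 : ∀ i j, 0 ≤ A i j) (hA1 : ∀ i, ∑ j, A i j = 1) (v : ι → ℝ) :
    ‖A.mulVec v‖ ≤ ‖v‖ := by
  refine (pi_norm_le_iff_of_nonneg (norm_nonneg v)).2 fun i => ?_
  calc ‖∑ j, A i j * v j‖ ≤ ∑ j, A i j * ‖v‖ := by
        refine norm_sum_le_of_le _ fun j _ => ?_
        rw [norm_mul, Real.norm_of_nonneg (hA0 i j)]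
        exact mul_le_mul_of_nonneg_left (norm_le_pi_norm v j) (hA0 i j)
    _ = ‖v‖ := by rw [← Finset.sum_mul, hA1, one_mul]

/-- A row-stochastic matrix is nonexpansive in the seminorm weighted by a stationary vector. -/
theorem sum_mul_mulVec_sq_le_of_stationary {ι : Type*} [Fintype ι] {A : Matrix ι ι ℝ}
    (hA0 : ∀ i j, 0 ≤ A i j) (hA1 : ∀ i, ∑ j, A i j = 1) {μ : ι → ℝ} (hμ0 : ∀ i, 0 ≤ μ i)
    (hstat : ∀ j, ∑ i, μ i * A i j = μ j) (v : ι → ℝ) :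
    ∑ i, μ i * (A.mulVec v i) ^ 2 ≤ ∑ i, μ i * v i ^ 2 := by
  calc ∑ i, μ i * (A.mulVec v i) ^ 2 ≤ ∑ i, μ i * ∑ j, A i j * v j ^ 2 := by
        refine Finset.sum_le_sum fun i _ => mul_le_mul_of_nonneg_left ?_ (hμ0 i)
        exact Real.pow_arith_mean_le_arith_mean_pow_of_even _ _ _ (fun j _ => hA0 i j) (hA1 i)
          even_two
    _ = ∑ j, ∑ i, μ i * A i j * v j ^ 2 := by
        rw [Finset.sum_comm]
        simp only [Finset.mul_sum, mul_assoc]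
    _ = ∑ i, μ i * v i ^ 2 := by simp only [← Finset.sum_mul, hstat]

/-- A quantity that does not increase under `A.mulVec` does not increase under its powers. -/
theorem pow_mulVec_le_of_mulVec_le {ι : Type*} [Fintype ι] [DecidableEq ι] {A : Matrix ι ι ℝ}
    {N : (ι → ℝ) → ℝ} (h : ∀ v, N (A.mulVec v) ≤ N v) (l : ℕ) (v : ι → ℝ) :
    N ((A ^ l).mulVec v) ≤ N v := by
  induction l with
  | zero => simp
  | succ l ih =>
    rw [pow_succ', ← Matrix.mulVec_mulVec]
    exact (h _).trans ih

/-- The series defining the `TD(λ)` operator converges. -/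
theorem summable_lambda_return {ι : Type*} [Fintype ι] [DecidableEq ι] {A : Matrix ι ι ℝ}
    (hA0 : ∀ i j, 0 ≤ A i j) (hA1 : ∀ i, ∑ j, A i j = 1) (r v : ι → ℝ) {γ lam : ℝ}
    (hγ0 : 0 ≤ γ) (hγ1 : γ < 1) (hlam0 : 0 ≤ lam) (hlam1 : lam < 1) (i : ι) :
    Summable fun l : ℕ => lam ^ l *
      ((∑ τ ∈ Finset.range (l + 1), γ ^ τ * ((A ^ τ).mulVec r) i) +
        γ ^ (l + 1) * ((A ^ (l + 1)).mulVec v) i) := by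
  have hpow (l : ℕ) (w : ι → ℝ) : ‖(A ^ l).mulVec w i‖ ≤ ‖w‖ :=
    (norm_le_pi_norm _ i).trans
      (pow_mulVec_le_of_mulVec_le (norm_mulVec_le_of_rowStochastic hA0 hA1) l w)
  refine Summable.of_norm_bounded
    ((summable_geometric_of_lt_one hlam0 hlam1).mul_right ((1 - γ)⁻¹ * ‖r‖ + ‖v‖)) fun l => ?_
  rw [norm_mul, norm_pow, Real.norm_of_nonneg hlam0]
  refine mul_le_mul_of_nonneg_left ((norm_add_le _ _).trans (add_le_add ?_ ?_)) (by positivity)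
  · calc ‖∑ τ ∈ Finset.range (l + 1), γ ^ τ * ((A ^ τ).mulVec r) i‖
        ≤ ∑ τ ∈ Finset.range (l + 1), γ ^ τ * ‖r‖ := by
          refine norm_sum_le_of_le _ fun τ _ => ?_
          rw [norm_mul, norm_pow, Real.norm_of_nonneg hγ0]
          exact mul_le_mul_of_nonneg_left (hpow τ r) (by positivity)
      _ ≤ (1 - γ)⁻¹ * ‖r‖ := by
          rw [← Finset.sum_mul, ← tsum_geometric_of_lt_one hγ0 hγ1]
          exact mul_le_mul_of_nonneg_right ((summable_geometric_of_lt_one hγ0 hγ1).sum_le_tsum _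
            fun τ _ => by positivity) (norm_nonneg r)
  · rw [norm_mul, norm_pow, Real.norm_of_nonneg hγ0]
    exact (mul_le_of_le_one_left (norm_nonneg _) (pow_le_one₀ hγ0 hγ1.le)).trans (hpow _ v)

/-- Countable triangle inequality for the seminorm `√(∑ i, μ i * v i ^ 2)`. -/
theorem sqrt_sum_mul_sq_le_of_hasSum {ι : Type*} [Fintype ι] {μ : ι → ℝ} (hμ0 : ∀ i, 0 ≤ μ i)
    {f : ℕ → ι → ℝ} {g : ℕ → ℝ} {v : ι → ℝ} {b : ℝ} (hf : HasSum f v) (hg : HasSum g b)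
    (h : ∀ l, Real.sqrt (∑ i, μ i * f l i ^ 2) ≤ g l) :
    Real.sqrt (∑ i, μ i * v i ^ 2) ≤ b := by
  let Φ (v : ι → ℝ) : EuclideanSpace ℝ ι := WithLp.toLp 2 fun i => Real.sqrt (μ i) * v i
  have hΦ (v : ι → ℝ) : ‖Φ v‖ = Real.sqrt (∑ i, μ i * v i ^ 2) := by
    simp [Φ, EuclideanSpace.norm_eq, mul_pow, Real.sq_sqrt (hμ0 _)]
  have hsum : HasSum (fun l => Φ (f l)) (Φ v) := by
    have hw : HasSum (fun l i => Real.sqrt (μ i) * f l i) fun i => Real.sqrt (μ i) * v i :=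
      Pi.hasSum.2 fun i => (Pi.hasSum.1 hf i).mul_left _
    exact hw.mapL (PiLp.continuousLinearEquiv 2 ℝ fun _ : ι => ℝ).symm.toContinuousLinearMap
  rw [← hΦ]
  exact hsum.norm_le_of_bounded hg fun l => (hΦ _).trans_le (h l)


/-- the map
`T^λ v = (1−λ) Σ_{l=0}^∞ λ^l [ Σ_{τ=0}^l γ^τ A^τ r + γ^{l+1} A^{l+1} v ]`
is a contraction with constant `γ(1−λ)/(1−γλ)` in the weighted norm
`‖v‖_M = (Σ_i μ_i v_i²)^{1/2}`, where `μ` is a stationary distribution of the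
row-stochastic matrix `A`. -/
theorem stmt10 (n : ℕ) (A : Matrix (Fin n) (Fin n) ℝ)
    (hA0 : ∀ i j, 0 ≤ A i j) (hA1 : ∀ i, ∑ j, A i j = 1)
    (μ : Fin n → ℝ) (hμ0 : ∀ i, 0 ≤ μ i) (hμ1 : ∑ i, μ i = 1)
    (hstat : ∀ j, ∑ i, μ i * A i j = μ j)
    (r : Fin n → ℝ) (γ : ℝ) (hγ0 : 0 < γ) (hγ1 : γ < 1)
    (lam : ℝ) (hlam0 : 0 ≤ lam) (hlam1 : lam < 1)
    (T : (Fin n → ℝ) → (Fin n → ℝ))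
    (hT : ∀ v i, T v i = (1 - lam) * ∑' l : ℕ, lam ^ l *
      ((∑ τ ∈ Finset.range (l + 1), γ ^ τ * ((A ^ τ).mulVec r) i) +
        γ ^ (l + 1) * ((A ^ (l + 1)).mulVec v) i))
    (v₁ v₂ : Fin n → ℝ) :
    Real.sqrt (∑ i, μ i * (T v₁ i - T v₂ i) ^ 2) ≤
      (γ * (1 - lam) / (1 - γ * lam)) *
        Real.sqrt (∑ i, μ i * (v₁ i - v₂ i) ^ 2) := by
  have hdiff : HasSum
      (fun (l : ℕ) i => (1 - lam) * lam ^ l * γ ^ (l + 1) * (A ^ (l + 1)).mulVec (v₁ - v₂) i)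
      (fun i => T v₁ i - T v₂ i) := by
    refine Pi.hasSum.2 fun i => ?_
    have hs (v : Fin n → ℝ) :=
      (summable_lambda_return hA0 hA1 r v hγ0.le hγ1 hlam0 hlam1 i).hasSum.mul_left (1 - lam)
    rw [hT, hT]
    refine ((hs v₁).sub (hs v₂)).congr_fun fun l => ?_
    rw [Matrix.mulVec_sub, Pi.sub_apply]
    ring
  have hcoef : HasSum (fun l : ℕ => (1 - lam) * lam ^ l * γ ^ (l + 1))
      (γ * (1 - lam) / (1 - γ * lam)) := by
    have hg := (hasSum_geometric_of_lt_one (mul_nonneg hγ0.le hlam0)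
      (mul_lt_one_of_nonneg_of_lt_one_left hγ0.le hγ1 hlam1.le)).mul_left (γ * (1 - lam))
    rw [← div_eq_mul_inv] at hg
    refine hg.congr_fun fun l => ?_
    ring
  refine sqrt_sum_mul_sq_le_of_hasSum hμ0 hdiff (hcoef.mul_right _) fun l => ?_
  have hc : 0 ≤ (1 - lam) * lam ^ l * γ ^ (l + 1) := by
    have := sub_nonneg.2 hlam1.le
    positivity
  simp only [mul_pow _ (Matrix.mulVec _ _ _), mul_left_comm (μ _), ← Finset.mul_sum]
  rw [Real.sqrt_mul (sq_nonneg _), Real.sqrt_sq hc]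
  exact mul_le_mul_of_nonneg_left (Real.sqrt_le_sqrt (pow_mulVec_le_of_mulVec_le
    (N := fun v => ∑ i, μ i * v i ^ 2)
    (sum_mul_mulVec_sq_le_of_stationary hA0 hA1 hμ0 hstat) (l + 1) (v₁ - v₂))) hc
end

section
/- Let A ∈ ℝ^{n×n} be a row-stochastic matrix whose stationary distribution μ has strictly positive entries, M = diag(μ), r ∈ ℝ^n, γ ∈ (0,1), λ ∈ [0,1), and let Ψ ∈ ℝ^{n×d} have full column rank. Let T^λ v = (1−λ) Σ_{l=0}^∞ λ^l [ Σ_{τ=0}^l γ^τ A^τ r + γ^{l+1} A^{l+1} v ], let Π = Ψ(ΨᵀMΨ)⁻¹ΨᵀM be the M-orthogonal projection onto the column space of Ψ, let v* be the unique solution of v = r + γAv, and suppose θ* ∈ ℝ^d satisfies Π T^λ (Ψθ*) = Ψθ*. Then ‖Ψθ* − v*‖_M ≤ [(1 − γλ)/(1 − γ)] ‖Π v* − v*‖_M. -/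
open Matrix

/-- The linear map `v ↦ √μ • v` into Euclidean space, which turns the `diag(μ)`-weighted norm into
the Euclidean norm. -/
noncomputable def weightedEmbedding {n : ℕ} (μ : Fin n → ℝ) :
    (Fin n → ℝ) →ₗ[ℝ] EuclideanSpace ℝ (Fin n) where
  toFun v := WithLp.toLp 2 fun i => Real.sqrt (μ i) * v i
  map_add' v w := by ext i; simp [mul_add]
  map_smul' c v := by ext i; simp [mul_left_comm]

theorem norm_weightedEmbedding {n : ℕ} {μ : Fin n → ℝ} (hμ : ∀ i, 0 ≤ μ i) (v : Fin n → ℝ) :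
    ‖weightedEmbedding μ v‖ = Real.sqrt (∑ i, μ i * v i ^ 2) := by
  rw [EuclideanSpace.norm_eq]
  congr 1
  refine Finset.sum_congr rfl fun i _ => ?_
  simp [weightedEmbedding, mul_pow, Real.sq_sqrt (hμ i)]

/-- A row-stochastic matrix is nonexpansive in the norm weighted by a stationary distribution. -/
theorem norm_weightedEmbedding_mulVec_le {n : ℕ} {A : Matrix (Fin n) (Fin n) ℝ}
    (hA0 : ∀ i j, 0 ≤ A i j) (hA1 : ∀ i, ∑ j, A i j = 1)
    {μ : Fin n → ℝ} (hμ : ∀ i, 0 ≤ μ i) (hstat : ∀ j, ∑ i, μ i * A i j = μ j)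
    (v : Fin n → ℝ) :
    ‖weightedEmbedding μ (A *ᵥ v)‖ ≤ ‖weightedEmbedding μ v‖ := by
  rw [norm_weightedEmbedding hμ, norm_weightedEmbedding hμ]
  refine Real.sqrt_le_sqrt ?_
  calc ∑ i, μ i * (A *ᵥ v) i ^ 2 ≤ ∑ i, μ i * ∑ j, A i j * v j ^ 2 := by
        refine Finset.sum_le_sum fun i _ => mul_le_mul_of_nonneg_left ?_ (hμ i)
        exact Real.pow_arith_mean_le_arith_mean_pow_of_even Finset.univ (A i) v
          (fun j _ => hA0 i j) (hA1 i) even_two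
    _ = ∑ j, (∑ i, μ i * A i j) * v j ^ 2 := by
        simp_rw [Finset.mul_sum, Finset.sum_mul]
        rw [Finset.sum_comm]
        simp_rw [mul_assoc]
    _ = ∑ j, μ j * v j ^ 2 := by simp_rw [hstat]

/-- A row-stochastic matrix is nonexpansive in the sup norm. -/
theorem norm_stochastic_mulVec_le {n : ℕ} {A : Matrix (Fin n) (Fin n) ℝ}
    (hA0 : ∀ i j, 0 ≤ A i j) (hA1 : ∀ i, ∑ j, A i j = 1) (v : Fin n → ℝ) :
    ‖A *ᵥ v‖ ≤ ‖v‖ := by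
  refine (pi_norm_le_iff_of_nonneg (norm_nonneg v)).2 fun i => ?_
  calc ‖∑ j, A i j * v j‖ ≤ ∑ j, A i j * ‖v‖ := by
        refine norm_sum_le_of_le _ fun j _ => ?_
        rw [norm_mul, Real.norm_of_nonneg (hA0 i j)]
        exact mul_le_mul_of_nonneg_left (norm_le_pi_norm v j) (hA0 i j)
    _ = ‖v‖ := by rw [← Finset.sum_mul, hA1, one_mul]

/-- If a matrix does not increase `f`, then neither do its powers. -/
theorem pow_mulVec_le_of_mulVec_le_s12 {n : ℕ} {A : Matrix (Fin n) (Fin n) ℝ}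
    {f : (Fin n → ℝ) → ℝ} (hf : ∀ v, f (A *ᵥ v) ≤ f v) (l : ℕ) (v : Fin n → ℝ) :
    f ((A ^ l) *ᵥ v) ≤ f v := by
  induction l with
  | zero => simp
  | succ l ih =>
    rw [pow_succ', ← Matrix.mulVec_mulVec]
    exact (hf _).trans ih

/-- The Bellman equation `v = r + γ A v` iterated `l` times. -/
theorem bellman_iterate {n : ℕ} {A : Matrix (Fin n) (Fin n) ℝ} {r v : Fin n → ℝ} {γ : ℝ}
    (hv : v = r + γ • A *ᵥ v) (l : ℕ) :
    v = ∑ τ ∈ Finset.range l, γ ^ τ • (A ^ τ) *ᵥ r + γ ^ l • (A ^ l) *ᵥ v := by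
  induction l with
  | zero => simp
  | succ l ih =>
    have h : (A ^ l) *ᵥ v = (A ^ l) *ᵥ r + γ • (A ^ (l + 1)) *ᵥ v := by
      conv_lhs => rw [hv]
      rw [Matrix.mulVec_add, Matrix.mulVec_smul, Matrix.mulVec_mulVec, ← pow_succ]
    conv_lhs => rw [ih, h]
    rw [Finset.sum_range_succ, smul_add, smul_smul, ← pow_succ, add_assoc]

/-- The weighted projection onto the column space of a matrix of full column rank is
nonexpansive. -/
theorem norm_weightedEmbedding_projection_le {n d : ℕ} {μ : Fin n → ℝ} (hμ : ∀ i, 0 < μ i)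
    {Ψ : Matrix (Fin n) (Fin d) ℝ} (hΨ : Function.Injective Ψ.mulVec) (v : Fin n → ℝ) :
    ‖weightedEmbedding μ ((Ψ * (Ψᵀ * diagonal μ * Ψ)⁻¹ * Ψᵀ * diagonal μ) *ᵥ v)‖ ≤
      ‖weightedEmbedding μ v‖ := by
  have hB : (Ψᵀ * diagonal μ * Ψ).PosDef := by
    have := (Matrix.PosDef.diagonal hμ).conjTranspose_mul_mul_same hΨ
    rwa [Matrix.conjTranspose_eq_transpose_of_trivial] at this
  have hdet : IsUnit (Ψᵀ * diagonal μ * Ψ).det := hB.det_pos.ne'.isUnit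
  set P := Ψ * (Ψᵀ * diagonal μ * Ψ)⁻¹ * Ψᵀ * diagonal μ with hP
  have hPM : Ψᵀ * diagonal μ * P = Ψᵀ * diagonal μ := by
    calc Ψᵀ * diagonal μ * P
        = (Ψᵀ * diagonal μ * Ψ) * (Ψᵀ * diagonal μ * Ψ)⁻¹ * (Ψᵀ * diagonal μ) := by
          simp only [hP, Matrix.mul_assoc]
      _ = Ψᵀ * diagonal μ := by rw [Matrix.mul_nonsing_inv _ hdet, Matrix.one_mul]
  have horth : (P *ᵥ v) ⬝ᵥ (diagonal μ *ᵥ (P *ᵥ v - v)) = 0 := by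
    have hzero : (Ψᵀ * diagonal μ) *ᵥ (P *ᵥ v - v) = 0 := by
      rw [Matrix.mulVec_sub, Matrix.mulVec_mulVec, hPM, sub_self]
    have hrange : P *ᵥ v = Ψ *ᵥ (((Ψᵀ * diagonal μ * Ψ)⁻¹ * Ψᵀ * diagonal μ) *ᵥ v) := by
      simp only [hP, Matrix.mulVec_mulVec, Matrix.mul_assoc]
    nth_rewrite 1 [hrange]
    rw [← Matrix.vecMul_transpose, ← Matrix.dotProduct_mulVec, Matrix.mulVec_mulVec, hzero,
      dotProduct_zero]
  have hsum : ∑ i, μ i * (P *ᵥ v) i ^ 2 - ∑ i, μ i * v i ^ 2 +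
      ∑ i, μ i * ((P *ᵥ v) i - v i) ^ 2 = 0 := by
    rw [← mul_zero 2, ← horth, dotProduct, Finset.mul_sum, ← Finset.sum_sub_distrib,
      ← Finset.sum_add_distrib]
    refine Finset.sum_congr rfl fun i _ => ?_
    rw [Matrix.mulVec_diagonal, Pi.sub_apply]
    ring
  have hnonneg : 0 ≤ ∑ i, μ i * ((P *ᵥ v) i - v i) ^ 2 :=
    Finset.sum_nonneg fun i _ => mul_nonneg (hμ i).le (sq_nonneg _)
  rw [norm_weightedEmbedding fun i => (hμ i).le, norm_weightedEmbedding fun i => (hμ i).le]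
  exact Real.sqrt_le_sqrt (by linarith)

/-- error bound for TD(λ) with function approximation.  With `A`
row-stochastic with strictly positive stationary distribution `μ`, `M = diag(μ)`,
`Ψ` of full column rank, `T^λ` the TD(λ) operator, `Π` the `M`-orthogonal
projection onto the column space of `Ψ`, `v*` the unique solution of
`v = r + γ A v`, and `θ*` a solution of `Π T^λ (Ψθ*) = Ψθ*`, one has
`‖Ψθ* − v*‖_M ≤ [(1 − γλ)/(1 − γ)] ‖Π v* − v*‖_M`. -/
theorem stmt12 (n d : ℕ) (A : Matrix (Fin n) (Fin n) ℝ)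
    (hA0 : ∀ i j, 0 ≤ A i j) (hA1 : ∀ i, ∑ j, A i j = 1)
    (μ : Fin n → ℝ) (hμ0 : ∀ i, 0 < μ i) (hμ1 : ∑ i, μ i = 1)
    (hstat : ∀ j, ∑ i, μ i * A i j = μ j)
    (M : Matrix (Fin n) (Fin n) ℝ) (hM : M = Matrix.diagonal μ)
    (r : Fin n → ℝ) (γ : ℝ) (hγ0 : 0 < γ) (hγ1 : γ < 1)
    (lam : ℝ) (hlam0 : 0 ≤ lam) (hlam1 : lam < 1)
    (Ψ : Matrix (Fin n) (Fin d) ℝ)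
    (hΨ : Function.Injective fun θ : Fin d → ℝ => Ψ.mulVec θ)
    (T : (Fin n → ℝ) → (Fin n → ℝ))
    (hT : ∀ v i, T v i = (1 - lam) * ∑' l : ℕ, lam ^ l *
      ((∑ τ ∈ Finset.range (l + 1), γ ^ τ * ((A ^ τ).mulVec r) i) +
        γ ^ (l + 1) * ((A ^ (l + 1)).mulVec v) i))
    (P : Matrix (Fin n) (Fin n) ℝ)
    (hP : P = Ψ * (Ψᵀ * M * Ψ)⁻¹ * Ψᵀ * M)
    (vstar : Fin n → ℝ)
    (hvstar : ∀ i, vstar i = r i + γ * ∑ j, A i j * vstar j)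
    (θstar : Fin d → ℝ)
    (hθstar : P.mulVec (T (Ψ.mulVec θstar)) = Ψ.mulVec θstar) :
    Real.sqrt (∑ i, μ i * (Ψ.mulVec θstar i - vstar i) ^ 2) ≤
      ((1 - γ * lam) / (1 - γ)) *
        Real.sqrt (∑ i, μ i * (P.mulVec vstar i - vstar i) ^ 2) := by
  have hμ : ∀ i, 0 ≤ μ i := fun i => (hμ0 i).le
  have hγlam : lam * γ < 1 := by nlinarith
  have hγlam0 : 0 ≤ lam * γ := mul_nonneg hlam0 hγ0.le
  set x := Ψ *ᵥ θstar with hx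
  set e := x - vstar with he
  have hbell : vstar = r + γ • A *ᵥ vstar := by
    ext i
    simpa [Matrix.mulVec, dotProduct] using hvstar i
  set f : ℕ → Fin n → ℝ := fun l => (lam ^ l * γ ^ (l + 1)) • (A ^ (l + 1)) *ᵥ e with hf
  have hgeom : HasSum (fun l : ℕ => lam ^ l * γ ^ (l + 1)) (γ * (1 - lam * γ)⁻¹) := by
    have hterm : (fun l : ℕ => lam ^ l * γ ^ (l + 1)) = fun l => γ * (lam * γ) ^ l := by
      funext l
      rw [mul_pow]
      ring
    rw [hterm]
    exact (hasSum_geometric_of_lt_one hγlam0 hγlam).mul_left γ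
  have hcoef : ∀ l : ℕ, 0 ≤ lam ^ l * γ ^ (l + 1) := fun l => by positivity
  have hfsum : Summable f := by
    refine Summable.of_norm_bounded (hgeom.summable.mul_right ‖e‖) fun l => ?_
    rw [hf, norm_smul, Real.norm_of_nonneg (hcoef l)]
    exact mul_le_mul_of_nonneg_left
      (pow_mulVec_le_of_mulVec_le_s12 (norm_stochastic_mulVec_le hA0 hA1) _ _) (hcoef l)
  have hTx : T x = vstar + (1 - lam) • ∑' l, f l := by
    ext i
    have hterm : ∀ l : ℕ, lam ^ l *
        ((∑ τ ∈ Finset.range (l + 1), γ ^ τ * ((A ^ τ) *ᵥ r) i) +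
          γ ^ (l + 1) * ((A ^ (l + 1)) *ᵥ x) i) = lam ^ l * vstar i + f l i := fun l => by
      have h := congrFun (bellman_iterate hbell (l + 1)) i
      simp only [Pi.add_apply, Finset.sum_apply, Pi.smul_apply, smul_eq_mul] at h
      simp only [hf, he, Matrix.mulVec_sub, Pi.smul_apply, Pi.sub_apply, smul_eq_mul]
      linear_combination (-lam ^ l) * h
    have hs : HasSum (fun l : ℕ => lam ^ l * vstar i + f l i)
        ((1 - lam)⁻¹ * vstar i + (∑' l, f l) i) :=
      ((hasSum_geometric_of_lt_one hlam0 hlam1).mul_right _).add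
        (Pi.hasSum.1 hfsum.hasSum i)
    rw [hT, tsum_congr hterm, hs.tsum_eq, mul_add,
      mul_inv_cancel_left₀ (sub_pos.2 hlam1).ne']
    rfl
  have hcontr : ‖weightedEmbedding μ (∑' l, f l)‖ ≤
      γ * (1 - lam * γ)⁻¹ * ‖weightedEmbedding μ e‖ := by
    have hmap := hfsum.hasSum.mapL (LinearMap.toContinuousLinearMap (weightedEmbedding μ))
    simp only [LinearMap.coe_toContinuousLinearMap'] at hmap
    rw [← hmap.tsum_eq]
    refine tsum_of_norm_bounded (hgeom.mul_right _) fun l => ?_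
    rw [hf, map_smul, norm_smul, Real.norm_of_nonneg (hcoef l)]
    exact mul_le_mul_of_nonneg_left (pow_mulVec_le_of_mulVec_le_s12
      (f := fun v => ‖weightedEmbedding μ v‖)
      (norm_weightedEmbedding_mulVec_le hA0 hA1 hμ hstat) _ _) (hcoef l)
  have hsplit : e = P *ᵥ ((1 - lam) • ∑' l, f l) + (P *ᵥ vstar - vstar) := by
    rw [he]
    nth_rewrite 1 [← hθstar]
    rw [hTx, Matrix.mulVec_add]
    abel
  have hPle : ‖weightedEmbedding μ (P *ᵥ ((1 - lam) • ∑' l, f l))‖ ≤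
      (1 - lam) * (γ * (1 - lam * γ)⁻¹ * ‖weightedEmbedding μ e‖) := by
    rw [hP, hM]
    refine (norm_weightedEmbedding_projection_le hμ0 hΨ _).trans ?_
    rw [map_smul, norm_smul, Real.norm_of_nonneg (sub_pos.2 hlam1).le]
    exact mul_le_mul_of_nonneg_left hcontr (sub_pos.2 hlam1).le
  have hmain : ‖weightedEmbedding μ e‖ ≤
      (1 - lam) * (γ * (1 - lam * γ)⁻¹ * ‖weightedEmbedding μ e‖) +
        ‖weightedEmbedding μ (P *ᵥ vstar - vstar)‖ := by
    conv_lhs => rw [hsplit, map_add]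
    exact (norm_add_le _ _).trans (add_le_add_left hPle _)
  have hbound : ‖weightedEmbedding μ e‖ ≤
      (1 - γ * lam) / (1 - γ) * ‖weightedEmbedding μ (P *ᵥ vstar - vstar)‖ := by
    have h1 : 0 < 1 - lam * γ := sub_pos.2 hγlam
    have hinv : (1 - lam * γ) * (1 - lam * γ)⁻¹ = 1 := mul_inv_cancel₀ h1.ne'
    rw [div_mul_eq_mul_div, le_div_iff₀ (sub_pos.2 hγ1)]
    have h2 := mul_le_mul_of_nonneg_left hmain h1.le
    linear_combination h2 + (1 - lam) * γ * ‖weightedEmbedding μ e‖ * hinv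
  rw [norm_weightedEmbedding hμ, norm_weightedEmbedding hμ] at hbound
  exact hbound
end

section
/- Let {N(t)}_{t ≥ 0} be a time-homogeneous Markov process on the finite state space [d] = {1,…,d} whose state transition matrix A ∈ ℝ^{d×d} is row-stochastic and irreducible. Let {β_t}_{t ≥ 0} be a nonincreasing sequence of real numbers in (0,1) with Σ_{t=0}^∞ β_t = ∞. Then, almost surely, Σ_{t=0}^∞ β_t · 1{N(t) = i} = ∞ for every state i ∈ [d]. -/
open MeasureTheory Filter

/-- Weighted form of Lévy's Borel-Cantelli lemma for the visits of a Markov chain to a state. -/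
theorem ae_tendsto_sum_visits_iff {ι Ω : Type*} [DecidableEq ι] [MeasurableSpace ι]
    [MeasurableSingletonClass ι] {m0 : MeasurableSpace Ω}
    (P : Measure Ω) [IsProbabilityMeasure P] (F : Filtration ℕ m0) (A : Matrix ι ι ℝ)
    (N : ℕ → Ω → ι) (hN : ∀ t, Measurable[F t] (N t)) (j : ι)
    (hMarkov : ∀ t, (P[(fun ω => if N (t + 1) ω = j then (1 : ℝ) else 0)|F t]) =ᵐ[P]
      (fun ω => A (N t ω) j))
    (c : ℕ → ℝ) (hc : ∀ t, c t ∈ Set.Icc (0 : ℝ) 1) :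
    ∀ᵐ ω ∂P,
      Tendsto (fun n => ∑ t ∈ Finset.range n, c t * (if N (t + 1) ω = j then (1 : ℝ) else 0))
        atTop atTop ↔
      Tendsto (fun n => ∑ t ∈ Finset.range n, c t * A (N t ω) j) atTop atTop := by
  let x : ℕ → Ω → ℝ := fun t ω => if N t ω = j then 1 else 0
  let f : ℕ → Ω → ℝ := fun n ω => ∑ t ∈ Finset.range n, c t * x (t + 1) ω
  have hx0 : ∀ t ω, 0 ≤ x t ω := fun t ω => by dsimp only [x]; split_ifs <;> norm_num
  have hx1 : ∀ t ω, x t ω ≤ 1 := fun t ω => by dsimp only [x]; split_ifs <;> norm_num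
  have hxm : ∀ t, StronglyMeasurable[F t] (x t) := fun t =>
    (Measurable.ite (hN t (measurableSet_singleton j)) measurable_const
      measurable_const).stronglyMeasurable
  have hdiff : ∀ n, f (n + 1) - f n = c n • x (n + 1) := fun n => by
    ext ω
    simp [f, Finset.sum_range_succ]
  have hxint : ∀ t, Integrable (x t) P := fun t =>
    Integrable.of_bound ((hxm t).mono (F.le t)).aestronglyMeasurable 1
      (Eventually.of_forall fun ω => by
        rw [Real.norm_eq_abs, abs_of_nonneg (hx0 t ω)]; exact hx1 t ω)
  have hstep : ∀ n ω, f (n + 1) ω - f n ω = c n * x (n + 1) ω := fun n ω =>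
    congrFun (hdiff n) ω
  have hlevy := tendsto_sum_indicator_atTop_iff (μ := P) (ℱ := F) (f := f) (R := 1)
    (Eventually.of_forall fun ω n => by
      have := mul_nonneg (hc n).1 (hx0 (n + 1) ω)
      linarith [hstep n ω])
    (fun n => Finset.stronglyMeasurable_fun_sum _ fun t ht =>
      ((hxm (t + 1)).mono (F.mono (Finset.mem_range.1 ht))).const_mul (c t))
    (fun n => integrable_finsetSum _ fun t _ => (hxint (t + 1)).const_mul (c t))
    (Eventually.of_forall fun ω n => by
      rw [hstep, abs_of_nonneg (mul_nonneg (hc n).1 (hx0 (n + 1) ω))]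
      exact mul_le_one₀ (hc n).2 (hx0 _ _) (hx1 _ _))
  have hpred : ∀ᵐ ω ∂P, ∀ n, (P[f (n + 1) - f n|F n]) ω = c n * A (N n ω) j := by
    refine ae_all_iff.2 fun n => ?_
    rw [hdiff]
    filter_upwards [condExp_smul (c n) (x (n + 1)) (F n) (μ := P), hMarkov n] with ω h₁ h₂
    rw [h₁, Pi.smul_apply, smul_eq_mul, h₂]
  filter_upwards [hlevy, hpred] with ω h₁ h₂
  simpa only [predictablePart, Finset.sum_apply, h₂] using h₁

/-- Shifting a nonincreasing nonnegative weight preserves divergence of a series whose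
coefficients lie in `[0, 1]`. -/
theorem tendsto_sum_shifted_weight {β x : ℕ → ℝ} (hβ : ∀ t, 0 ≤ β t)
    (hmono : ∀ t, β (t + 1) ≤ β t) (hx : ∀ t, x t ≤ 1)
    (h : Tendsto (fun n => ∑ t ∈ Finset.range n, β t * x t) atTop atTop) :
    Tendsto (fun n => ∑ t ∈ Finset.range n, β (t + 1) * x t) atTop atTop := by
  refine tendsto_atTop_mono (fun n => ?_) (tendsto_atTop_add_const_right atTop (-β 0) h)
  have hle : ∑ t ∈ Finset.range n, (β t - β (t + 1)) * x t ≤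
      ∑ t ∈ Finset.range n, (β t - β (t + 1)) :=
    Finset.sum_le_sum fun t _ => mul_le_of_le_one_right (sub_nonneg.2 (hmono t)) (hx t)
  rw [Finset.sum_range_sub'] at hle
  simp only [sub_mul, Finset.sum_sub_distrib] at hle
  linarith [hβ n]

/-- A property of states that propagates along positive entries of a nonnegative matrix
propagates along positive entries of its powers. -/
theorem Matrix.of_pow_apply_pos {ι : Type*} [Fintype ι] [DecidableEq ι] {A : Matrix ι ι ℝ}
    (hA : ∀ i j, 0 ≤ A i j) {p : ι → Prop} (hp : ∀ i j, 0 < A i j → p i → p j) {i : ι}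
    (hi : p i) (l : ℕ) (j : ι) (h : 0 < (A ^ l) i j) : p j := by
  induction l generalizing j with
  | zero =>
    rw [pow_zero, Matrix.one_apply] at h
    split_ifs at h with hij
    · exact hij ▸ hi
    · exact absurd h (lt_irrefl 0)
  | succ l ih =>
    rw [pow_succ, Matrix.mul_apply] at h
    obtain ⟨k, -, hk⟩ := Finset.exists_lt_of_sum_lt (by simpa using h :
      ∑ _k : ι, (0 : ℝ) < ∑ k, (A ^ l) i k * A k j)
    have hkj : 0 < A k j := (hA k j).lt_of_ne' (right_ne_zero_of_mul hk.ne')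
    exact hp k j hkj (ih k (pos_of_mul_pos_left hk hkj.le))

/-- If a series of nonnegative weights diverges, then so does its restriction to the visits of some
state of a finite-state sequence. -/
theorem exists_tendsto_sum_visits {ι : Type*} [Fintype ι] [DecidableEq ι] {β : ℕ → ℝ}
    (hβ : ∀ t, 0 ≤ β t)
    (hdiv : Tendsto (fun n => ∑ t ∈ Finset.range n, β t) atTop atTop) (s : ℕ → ι) :
    ∃ i, Tendsto (fun n => ∑ t ∈ Finset.range n, β t * (if s t = i then (1 : ℝ) else 0))
      atTop atTop := by
  by_contra! hne
  have hlim : ∀ i, ∃ L, Tendsto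
      (fun n => ∑ t ∈ Finset.range n, β t * (if s t = i then (1 : ℝ) else 0)) atTop (nhds L) :=
    fun i => (tendsto_atTop_of_monotone (monotone_nat_of_le_succ fun n => by
      rw [Finset.sum_range_succ]
      exact le_add_of_nonneg_right (mul_nonneg (hβ n) (by split_ifs <;> norm_num)))).resolve_left (hne i)
  choose L hL using hlim
  refine not_tendsto_nhds_of_tendsto_atTop hdiv (∑ i, L i) ?_
  refine (tendsto_finsetSum Finset.univ fun i _ => hL i).congr fun n => ?_
  rw [Finset.sum_comm]
  simp

/-- let `{N(t)}` be a time-homogeneous Markov process on `[d]`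
(adapted to a filtration `F`, with `P(N(t+1) = j | F_t) = A_{N(t),j}` a.s.)
whose transition matrix `A` is row-stochastic and irreducible.  If `{β_t}` is a
nonincreasing sequence in `(0,1)` with `Σ β_t = ∞` (i.e. partial sums tend to
`∞`), then almost surely `Σ_t β_t 1{N(t)=i} = ∞` for every state `i`. -/
theorem stmt18 {d : ℕ} {Ω : Type*} {m0 : MeasurableSpace Ω}
    (P : Measure Ω) [IsProbabilityMeasure P]
    (F : Filtration ℕ m0)
    (A : Matrix (Fin d) (Fin d) ℝ)
    (hA0 : ∀ i j, 0 ≤ A i j) (hA1 : ∀ i, ∑ j, A i j = 1)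
    (hirr : ∀ i j : Fin d, ∃ l : ℕ, 1 ≤ l ∧ 0 < (A ^ l) i j)
    (N : ℕ → Ω → Fin d)
    (hNad : ∀ t, Measurable[F t] (N t))
    (hMarkov : ∀ (t : ℕ) (j : Fin d),
      (P[(fun ω => if N (t + 1) ω = j then (1 : ℝ) else 0)|F t]) =ᵐ[P]
        (fun ω => A (N t ω) j))
    (β : ℕ → ℝ) (hβ : ∀ t, β t ∈ Set.Ioo (0 : ℝ) 1)
    (hmono : ∀ t, β (t + 1) ≤ β t)
    (hdiv : Tendsto (fun T => ∑ t ∈ Finset.range T, β t) atTop atTop) :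
    ∀ᵐ ω ∂P, ∀ i : Fin d,
      Tendsto (fun T => ∑ t ∈ Finset.range T,
        β t * (if N t ω = i then (1 : ℝ) else 0)) atTop atTop := by
  have hlevy := ae_all_iff.2 fun j => ae_tendsto_sum_visits_iff P F A N hNad j
    (fun t => hMarkov t j) (fun t => β (t + 1))
    (fun t => ⟨(hβ (t + 1)).1.le, (hβ (t + 1)).2.le⟩)
  filter_upwards [hlevy] with ω hω j
  obtain ⟨i, hi⟩ := exists_tendsto_sum_visits (fun t => (hβ t).1.le) hdiv (fun t => N t ω)
  obtain ⟨l, -, hl⟩ := hirr i j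
  refine Matrix.of_pow_apply_pos hA0 (p := fun i => Tendsto (fun T => ∑ t ∈ Finset.range T,
    β t * (if N t ω = i then (1 : ℝ) else 0)) atTop atTop) (fun i j hij hi => ?_) hi l j hl
  rw [← tendsto_add_atTop_iff_nat 1]
  simp only [Finset.sum_range_succ']
  refine tendsto_atTop_add_const_right atTop _ ((hω j).2 ?_)
  have hshift := tendsto_sum_shifted_weight (fun t => (hβ t).1.le) hmono
    (fun t => by split_ifs <;> norm_num) hi
  refine tendsto_atTop_mono (fun n => ?_) (hshift.const_mul_atTop hij)
  rw [Finset.mul_sum]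
  refine Finset.sum_le_sum fun t _ => ?_
  split_ifs with h
  · rw [h, mul_one, mul_comm]
  · simpa using mul_nonneg (hβ (t + 1)).1.le (hA0 (N t ω) j)
end
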